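/- Let d ≥ 2, let (F1,F2,F3) be a triple of complete flags of ℂ^d in general position, and let (z_j)_{j∈B} be a family of nonzero complex numbers. Then there exists a ∈ GL_d(ℂ) such that: a preserves the flag F2 and the lines F1^1 and F3^1; the triple (F1,F2,a·F3) is in general position; and T^j(F1,F2,a·F3) = z_j·T^j(F1,F2,F3) for every j ∈ B. Moreover, any two elements of GL_d(ℂ) with these properties differ by multiplication by a nonzero scalar. -/

import Mathlib

noncomputable section

/-- A complete flag of `ℂ^d`: an increasing chain of subspaces `F 0 ⊆ F 1 ⊆ ⋯` of `ℂ^d`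
with `dim (F k) = k` for all `k ≤ d`. -/
def IsCompleteFlag (d : ℕ) (F : ℕ → Submodule ℂ (Fin d → ℂ)) : Prop :=
  Monotone F ∧ ∀ k, k ≤ d → Module.finrank ℂ ↥(F k) = k

/-- Two complete flags of `ℂ^d` are transverse: `F^k + G^(d-k) = ℂ^d` for all `k`. -/
def TransverseFlags (d : ℕ) (F G : ℕ → Submodule ℂ (Fin d → ℂ)) : Prop :=
  ∀ k, k ≤ d → F k ⊔ G (d - k) = ⊤

/-- The flag `g · F`, whose subspaces are the images `g (F k)`. -/
def flagMap (d : ℕ) (g : Matrix (Fin d) (Fin d) ℂ) (F : ℕ → Submodule ℂ (Fin d → ℂ)) :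
    ℕ → Submodule ℂ (Fin d → ℂ) :=
  fun k => Submodule.map g.mulVecLin (F k)

/-- A triple of flags of `ℂ^d` in general position:
`F1^k1 + F2^k2 + F3^k3 = ℂ^d` whenever `k1 + k2 + k3 = d`. -/
def GenPos3 (d : ℕ) (F1 F2 F3 : ℕ → Submodule ℂ (Fin d → ℂ)) : Prop :=
  ∀ k1 k2 k3 : ℕ, k1 + k2 + k3 = d → F1 k1 ⊔ F2 k2 ⊔ F3 k3 = ⊤

/-- The index set `B`: triples of positive integers summing to `d`. -/
def memB (d : ℕ) (j : ℕ × ℕ × ℕ) : Prop :=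
  0 < j.1 ∧ 0 < j.2.1 ∧ 0 < j.2.2 ∧ j.1 + j.2.1 + j.2.2 = d

/-- The index set `A`: pairs of positive integers summing to `d`. -/
def memA (d : ℕ) (i : ℕ × ℕ) : Prop :=
  0 < i.1 ∧ 0 < i.2 ∧ i.1 + i.2 = d

/-- `v 0, v 1, …, v (d-1)` is a basis adapted to the flag `F`: for every `k ≤ d`, the
subspace `F k` is spanned by the first `k` vectors.  A nonzero element `f^k` of the line
`⋀^k F^k` is then given by `v 0 ∧ ⋯ ∧ v (k-1)`. -/
def IsAdaptedBasis (d : ℕ) (F : ℕ → Submodule ℂ (Fin d → ℂ)) (v : ℕ → Fin d → ℂ) : Prop :=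
  ∀ k, k ≤ d → F k = Submodule.span ℂ (v '' {m | m < k})

/-- A choice of adapted basis for a flag. -/
noncomputable def flagBasis (d : ℕ) (F : ℕ → Submodule ℂ (Fin d → ℂ)) : ℕ → Fin d → ℂ :=
  Classical.epsilon (IsAdaptedBasis d F)

/-- The scalar `f1^a ∧ f2^b ∧ f3^(d-a-b)`: the wedge product of the first `a` vectors of
`v1`, the first `b` vectors of `v2` and the first `d - a - b` vectors of `v3`, viewed as a
complex number via the determinant (i.e. via the standard identification `⋀^d ℂ^d ≅ ℂ`). -/
noncomputable def wedgeDet (d a b : ℕ) (v1 v2 v3 : ℕ → Fin d → ℂ) : ℂ :=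
  Matrix.det (Matrix.of fun (i j : Fin d) =>
    if (i : ℕ) < a then v1 (i : ℕ) j
    else if (i : ℕ) < a + b then v2 ((i : ℕ) - a) j
    else v3 ((i : ℕ) - a - b) j)

/-- The triple ratio `T^j(F1,F2,F3)` of a triple of flags in general position,
for `j = (j1,j2,j3)` with `j1 + j2 + j3 = d`. -/
noncomputable def tripleRatio (d : ℕ) (j : ℕ × ℕ × ℕ)
    (F1 F2 F3 : ℕ → Submodule ℂ (Fin d → ℂ)) : ℂ :=
  (wedgeDet d (j.1 + 1) j.2.1 (flagBasis d F1) (flagBasis d F2) (flagBasis d F3) *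
      wedgeDet d j.1 (j.2.1 - 1) (flagBasis d F1) (flagBasis d F2) (flagBasis d F3) *
      wedgeDet d (j.1 - 1) (j.2.1 + 1) (flagBasis d F1) (flagBasis d F2) (flagBasis d F3)) /
    (wedgeDet d (j.1 - 1) j.2.1 (flagBasis d F1) (flagBasis d F2) (flagBasis d F3) *
      wedgeDet d j.1 (j.2.1 + 1) (flagBasis d F1) (flagBasis d F2) (flagBasis d F3) *
      wedgeDet d (j.1 + 1) (j.2.1 - 1) (flagBasis d F1) (flagBasis d F2) (flagBasis d F3))

/-- A choice of nonzero vector in a (1-dimensional) subspace. -/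
noncomputable def lineVec (d : ℕ) (l : Submodule ℂ (Fin d → ℂ)) : Fin d → ℂ :=
  Classical.epsilon fun v => v ∈ l ∧ v ≠ 0

/-- The double ratio `D^i(G1,G2,ℓ1,ℓ2)` of a pair of transverse flags and a pair of lines,
for `i = (i1,i2)` with `i1 + i2 = d`. -/
noncomputable def doubleRatioLine (d : ℕ) (i : ℕ × ℕ) (G1 G2 : ℕ → Submodule ℂ (Fin d → ℂ))
    (l1 l2 : Submodule ℂ (Fin d → ℂ)) : ℂ :=
  -((wedgeDet d i.1 (i.2 - 1) (flagBasis d G1) (flagBasis d G2) (fun _ => lineVec d l1) *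
        wedgeDet d (i.1 - 1) i.2 (flagBasis d G1) (flagBasis d G2) (fun _ => lineVec d l2)) /
      (wedgeDet d i.1 (i.2 - 1) (flagBasis d G1) (flagBasis d G2) (fun _ => lineVec d l2) *
        wedgeDet d (i.1 - 1) i.2 (flagBasis d G1) (flagBasis d G2) (fun _ => lineVec d l1)))

/-- The double ratio `D^i(G1,G2,H1,H2)` of four flags, which only depends on the
`1`-dimensional parts of `H1` and `H2`. -/
noncomputable def doubleRatio (d : ℕ) (i : ℕ × ℕ)
    (G1 G2 H1 H2 : ℕ → Submodule ℂ (Fin d → ℂ)) : ℂ :=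
  doubleRatioLine d i G1 G2 (H1 1) (H2 1)

/-- span of the first `k` vectors of a family -/
def spk {d : ℕ} (v : ℕ → Fin d → ℂ) (k : ℕ) : Submodule ℂ (Fin d → ℂ) :=
  Submodule.span ℂ (v '' {m | m < k})

theorem spk_mem {d : ℕ} (v : ℕ → Fin d → ℂ) {m k : ℕ} (h : m < k) : v m ∈ spk v k :=
  Submodule.subset_span ⟨m, h, rfl⟩

theorem spk_le {d : ℕ} {v : ℕ → Fin d → ℂ} {k : ℕ} {S : Submodule ℂ (Fin d → ℂ)}
    (h : ∀ m, m < k → v m ∈ S) : spk v k ≤ S := by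
  refine Submodule.span_le.2 ?_
  rintro _ ⟨m, hm, rfl⟩
  exact h m hm

theorem spk_zero {d : ℕ} (v : ℕ → Fin d → ℂ) : spk v 0 = ⊥ := by
  simp [spk]

theorem spk_mono {d : ℕ} (v : ℕ → Fin d → ℂ) : Monotone (spk v) := by
  intro a b hab
  exact spk_le fun m hm => spk_mem v (lt_of_lt_of_le hm hab)

theorem spk_succ {d : ℕ} (v : ℕ → Fin d → ℂ) (k : ℕ) :
    spk v (k + 1) = spk v k ⊔ Submodule.span ℂ {v k} := by
  apply le_antisymm
  · refine spk_le fun m hm => ?_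
    rcases Nat.lt_succ_iff_lt_or_eq.1 hm with h | h
    · exact Submodule.mem_sup_left (spk_mem v h)
    · subst h
      exact Submodule.mem_sup_right (Submodule.mem_span_singleton_self _)
  · refine sup_le (spk_mono v (Nat.le_succ k)) ?_
    rw [Submodule.span_singleton_le_iff_mem]
    exact spk_mem v (Nat.lt_succ_self k)

theorem spk_congr {d : ℕ} {v w : ℕ → Fin d → ℂ} {k : ℕ} (h : ∀ m, m < k → v m = w m) :
    spk v k = spk w k := by
  apply le_antisymm
  · exact spk_le fun m hm => by rw [h m hm]; exact spk_mem w hm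
  · exact spk_le fun m hm => by rw [← h m hm]; exact spk_mem v hm

theorem spk_exists {d : ℕ} (v : ℕ → Fin d → ℂ) (k : ℕ) :
    ∀ x, x ∈ spk v k → ∃ C : ℕ → ℂ, x = ∑ l ∈ Finset.range k, C l • v l := by
  induction k with
  | zero =>
    intro x hx
    rw [spk_zero] at hx
    exact ⟨0, by simpa using hx⟩
  | succ k ih =>
    intro x hx
    rw [spk_succ] at hx
    obtain ⟨y, hy, w, hw, rfl⟩ := Submodule.mem_sup.1 hx
    obtain ⟨c, rfl⟩ := Submodule.mem_span_singleton.1 hw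
    obtain ⟨C, rfl⟩ := ih y hy
    refine ⟨Function.update C k c, ?_⟩
    rw [Finset.sum_range_succ]
    congr 1
    · refine Finset.sum_congr rfl fun l hl => ?_
      rw [Function.update_of_ne (Finset.mem_range.1 hl).ne]
    · simp

theorem wedgeDet_congr (d a b : ℕ) (v1 v2 : ℕ → Fin d → ℂ) {v w : ℕ → Fin d → ℂ}
    (h : ∀ m, m < d - a - b → v m = w m) : wedgeDet d a b v1 v2 v = wedgeDet d a b v1 v2 w := by
  unfold wedgeDet
  congr 1
  ext i j
  simp only [Matrix.of_apply]
  split_ifs with h1 h2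
  · rfl
  · rfl
  · rw [h _ (by have := i.2; omega)]

theorem det_ne_zero_iff_span {d : ℕ} (M : Matrix (Fin d) (Fin d) ℂ) :
    M.det ≠ 0 ↔ Submodule.span ℂ (Set.range M.row) = ⊤ := by
  rw [← isUnit_iff_ne_zero, ← Matrix.isUnit_iff_isUnit_det,
    ← Matrix.linearIndependent_rows_iff_isUnit]
  constructor
  · intro h
    exact h.span_eq_top_of_card_eq_finrank' (by simp)
  · intro h
    exact linearIndependent_of_top_le_span_of_card_eq_finrank h.ge (by simp)

theorem wedgeDet_ne_zero_iff {d a b c : ℕ} (h : a + b + c = d) (v1 v2 v3 : ℕ → Fin d → ℂ) :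
    wedgeDet d a b v1 v2 v3 ≠ 0 ↔ spk v1 a ⊔ spk v2 b ⊔ spk v3 c = ⊤ := by
  unfold wedgeDet
  rw [det_ne_zero_iff_span]
  have key : ∀ i : Fin d, (Matrix.of fun (i j : Fin d) =>
    if (i : ℕ) < a then v1 (i : ℕ) j
    else if (i : ℕ) < a + b then v2 ((i : ℕ) - a) j
    else v3 ((i : ℕ) - a - b) j).row i = if (i : ℕ) < a then v1 (i : ℕ)
    else if (i : ℕ) < a + b then v2 ((i : ℕ) - a)
    else v3 ((i : ℕ) - a - b) := by
    intro i
    ext j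
    simp only [Matrix.row, Matrix.of_apply]
    split_ifs <;> rfl
  suffices hh : Submodule.span ℂ (Set.range (Matrix.of fun (i j : Fin d) =>
    if (i : ℕ) < a then v1 (i : ℕ) j
    else if (i : ℕ) < a + b then v2 ((i : ℕ) - a) j
    else v3 ((i : ℕ) - a - b) j).row) = spk v1 a ⊔ spk v2 b ⊔ spk v3 c by rw [hh]
  apply le_antisymm
  · rw [Submodule.span_le]
    rintro _ ⟨i, rfl⟩
    rw [key]
    have := i.2
    split_ifs with h1 h2
    · exact Submodule.mem_sup_left (Submodule.mem_sup_left (spk_mem _ h1))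
    · exact Submodule.mem_sup_left (Submodule.mem_sup_right (spk_mem _ (by omega)))
    · exact Submodule.mem_sup_right (spk_mem _ (by omega))
  · refine sup_le (sup_le (spk_le fun m hm => ?_) (spk_le fun m hm => ?_)) (spk_le fun m hm => ?_)
    · refine Submodule.subset_span ⟨⟨m, by omega⟩, ?_⟩
      rw [key]; simp [hm]
    · refine Submodule.subset_span ⟨⟨a + m, by omega⟩, ?_⟩
      rw [key]; simp [hm]
    · refine Submodule.subset_span ⟨⟨a + b + m, by omega⟩, ?_⟩
      rw [key]
      have e1 : ¬ (a + b + m < a) := by omega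
      have e2 : ¬ (a + b + m < a + b) := by omega
      have e3 : a + b + m - a - b = m := by omega
      simp [e1, e3]

theorem wedgeDet_change {d c : ℕ} (v1 v2 v w : ℕ → Fin d → ℂ) (h : spk w c ≤ spk v c) :
    ∃ κ : ℂ, ∀ a b, a + b + c = d → wedgeDet d a b v1 v2 w = κ * wedgeDet d a b v1 v2 v := by
  have h1 : ∀ k, ∃ C : ℕ → ℂ, k < c → w k = ∑ l ∈ Finset.range c, C l • v l := by
    intro k
    by_cases hk : k < c
    · obtain ⟨C, hC⟩ := spk_exists v c (w k) (h (spk_mem w hk))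
      exact ⟨C, fun _ => hC⟩
    · exact ⟨0, fun h => absurd h hk⟩
  choose C hC using h1
  refine ⟨Matrix.det (Matrix.of fun (i l : Fin d) => if (i : ℕ) < d - c then (if l = i then 1 else 0)
    else if (l : ℕ) < d - c then 0 else C (i - (d - c)) (l - (d - c))), ?_⟩
  intro a b habc
  unfold wedgeDet
  rw [← Matrix.det_mul]
  congr 1
  ext i j
  have hi := i.2
  rw [Matrix.mul_apply]
  simp only [Matrix.of_apply]
  by_cases hi2 : (i : ℕ) < d - c
  · simp only [hi2, if_true]
    rw [Finset.sum_eq_single i]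
    · have h3 : (i : ℕ) < a + b := by omega
      simp [h3]
    · intro l _ hl
      simp [hl]
    · simp
  · have h3 : ¬ (i : ℕ) < a + b := by omega
    have h4 : ¬ (i : ℕ) < a := by omega
    simp only [hi2, h3, h4, if_false]
    rw [hC _ (by omega)]
    rw [Fin.sum_univ_eq_sum_range (fun l => (if l < d - c then 0 else C (↑i - (d - c)) (l - (d - c))) *
      if l < a then v1 l j else if l < a + b then v2 (l - a) j else v (l - a - b) j) d]
    have e : d = (a + b) + c := by omega
    have e2 : d - c = a + b := by omega
    rw [e2]
    have e6 : Finset.range d = Finset.range (a + b + c) := by rw [habc]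
    rw [e6, Finset.sum_range_add, Finset.sum_apply,
      Finset.sum_eq_zero (s := Finset.range (a + b)), zero_add]
    · refine Finset.sum_congr rfl fun l hl => ?_
      have e1 : ¬ (a + b + l < a) := by omega
      have e2 : ¬ (a + b + l < a + b) := by omega
      have e3 : a + b + l - a - b = l := by omega
      have e4 : a + b + l - (a + b) = l := by omega
      have e5 : (i : ℕ) - a - b = i - (a + b) := by omega
      simp [e1, e3, e5]
    · intro l hl
      simp [Finset.mem_range.1 hl]

theorem wedgeDet_linear {d a b c : ℕ} (h : a + b + c + 1 = d) (v1 v2 v : ℕ → Fin d → ℂ) :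
    ∃ φ : (Fin d → ℂ) →ₗ[ℂ] ℂ, ∀ x, φ x = wedgeDet d a b v1 v2 (Function.update v c x) := by
  have hd : d - 1 < d := by omega
  let M : Matrix (Fin d) (Fin d) ℂ := Matrix.of fun (i j : Fin d) =>
    if (i : ℕ) < a then v1 (i : ℕ) j
    else if (i : ℕ) < a + b then v2 ((i : ℕ) - a) j
    else v ((i : ℕ) - a - b) j
  refine ⟨⟨⟨fun x => (M.updateRow ⟨d - 1, hd⟩ x).det, Matrix.det_updateRow_add M _⟩,
    fun c x => Matrix.det_updateRow_smul M _ c x⟩, ?_⟩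
  intro x
  unfold wedgeDet
  change Matrix.det _ = _
  congr 1
  ext i j
  have hi := i.2
  by_cases hi2 : i = ⟨d - 1, hd⟩
  · subst hi2
    have e1 : ¬ (d - 1 < a) := by omega
    have e2 : ¬ (d - 1 < a + b) := by omega
    have e3 : d - 1 - a - b = c := by omega
    simp [e1, e2, e3]
  · rw [Matrix.updateRow_ne hi2]
    have : (i : ℕ) ≠ d - 1 := fun hh => hi2 (Fin.ext hh)
    simp only [M, Matrix.of_apply]
    split_ifs with h1 h2
    · rfl
    · rfl
    · rw [Function.update_of_ne (by omega)]

theorem wedgeDet_update_v1 {d a b c k : ℕ} (h : a + b + c + 1 = d) (v1 v2 v : ℕ → Fin d → ℂ)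
    (hk : k < a) : wedgeDet d a b v1 v2 (Function.update v c (v1 k)) = 0 := by
  unfold wedgeDet
  have hd : d - 1 < d := by omega
  apply Matrix.det_zero_of_row_eq (i := ⟨k, by omega⟩) (j := ⟨d - 1, hd⟩)
  · intro hh
    have := Fin.mk.inj hh
    omega
  · ext j
    have e1 : ¬ (d - 1 < a) := by omega
    have e2 : ¬ (d - 1 < a + b) := by omega
    have e3 : d - 1 - a - b = c := by omega
    simp [e1, e2, e3, hk]

theorem wedgeDet_update_v3 {d a b c k : ℕ} (h : a + b + c + 1 = d) (v1 v2 v : ℕ → Fin d → ℂ)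
    (hk : k < c) : wedgeDet d a b v1 v2 (Function.update v c (v k)) = 0 := by
  unfold wedgeDet
  have hd : d - 1 < d := by omega
  apply Matrix.det_zero_of_row_eq (i := ⟨a + b + k, by omega⟩) (j := ⟨d - 1, hd⟩)
  · intro hh
    have := Fin.mk.inj hh
    omega
  · ext j
    have e1 : ¬ (d - 1 < a) := by omega
    have e2 : ¬ (d - 1 < a + b) := by omega
    have e3 : d - 1 - a - b = c := by omega
    have e4 : ¬ (a + b + k < a) := by omega
    have e5 : ¬ (a + b + k < a + b) := by omega
    have e6 : a + b + k - a - b = k := by omega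
    simp [e1, e2, e3, e4, e6, hk.ne]

theorem spk_update {d : ℕ} (v : ℕ → Fin d → ℂ) (c : ℕ) (x : Fin d → ℂ) {k : ℕ} (hk : k ≤ c) :
    spk (Function.update v c x) k = spk v k :=
  spk_congr fun m hm => Function.update_of_ne (by omega) _ _

theorem spk_update_succ {d : ℕ} (v : ℕ → Fin d → ℂ) (c : ℕ) (x : Fin d → ℂ) :
    spk (Function.update v c x) (c + 1) = spk v c ⊔ Submodule.span ℂ {x} := by
  rw [spk_succ, spk_update v c x le_rfl, Function.update_self]

theorem wedgeDet_update_diag {d a b c : ℕ} (h : a + b + c + 1 = d) (v1 v2 v : ℕ → Fin d → ℂ)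
    (hg : spk v1 (a + 1) ⊔ spk v2 b ⊔ spk v c = ⊤) :
    wedgeDet d a b v1 v2 (Function.update v c (v1 a)) ≠ 0 := by
  rw [wedgeDet_ne_zero_iff (c := c + 1) (by omega), spk_update_succ, eq_top_iff, ← hg, spk_succ]
  refine sup_le (sup_le (sup_le ?_ ?_) ?_) ?_
  · exact le_sup_of_le_left le_sup_left
  · exact le_sup_of_le_right le_sup_right
  · exact le_sup_of_le_left le_sup_right
  · exact le_sup_of_le_right le_sup_left

theorem tri_det {d c : ℕ} (hc : c < d) (v1 v2 v : ℕ → Fin d → ℂ)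
    (hg : ∀ a b, a + b + c = d → spk v1 a ⊔ spk v2 b ⊔ spk v c = ⊤) :
    IsUnit (Matrix.of fun (a k : Fin (d - c)) =>
      wedgeDet d a (d - c - 1 - a) v1 v2 (Function.update v c (v1 k))) := by
  rw [Matrix.isUnit_iff_isUnit_det, isUnit_iff_ne_zero, Matrix.det_of_isUpperTriangular]
  · rw [Finset.prod_ne_zero_iff]
    intro a _
    have := a.2
    exact wedgeDet_update_diag (by omega) v1 v2 v (hg _ _ (by omega))
  · intro a k hak
    have := a.2
    exact wedgeDet_update_v1 (by omega) v1 v2 v hak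

theorem tri_sum {d a b c n : ℕ} (h : a + b + c + 1 = d) (v1 v2 v : ℕ → Fin d → ℂ) (X : Fin n → ℂ) :
    wedgeDet d a b v1 v2 (Function.update v c (∑ k : Fin n, X k • v1 k)) =
      ∑ k : Fin n, wedgeDet d a b v1 v2 (Function.update v c (v1 k)) * X k := by
  obtain ⟨φ, hφ⟩ := wedgeDet_linear h v1 v2 v
  simp only [← hφ, map_sum, map_smul, smul_eq_mul, mul_comm]

theorem tri_surj {d c : ℕ} (hc : c < d) (v1 v2 v : ℕ → Fin d → ℂ)
    (hg : ∀ a b, a + b + c = d → spk v1 a ⊔ spk v2 b ⊔ spk v c = ⊤) (y : ℕ → ℂ) :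
    ∃ x, ∀ a b, a + b + c + 1 = d → wedgeDet d a b v1 v2 (Function.update v c x) = y a := by
  have h1 := tri_det hc v1 v2 v hg
  obtain ⟨X, hX⟩ := (Matrix.mulVec_surjective_iff_isUnit.2 h1) (fun a => y a)
  refine ⟨∑ k, X k • v1 k, fun a b hab => ?_⟩
  rw [tri_sum hab]
  have h2 := congrFun hX ⟨a, by omega⟩
  have hb : b = d - c - 1 - a := by omega
  subst hb
  simpa [Matrix.mulVec, dotProduct] using h2

theorem tri_inj {d c : ℕ} (hc : c < d) (v1 v2 v : ℕ → Fin d → ℂ)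
    (hg : ∀ a b, a + b + c = d → spk v1 a ⊔ spk v2 b ⊔ spk v c = ⊤) (x : Fin d → ℂ)
    (hx : ∀ a b, a + b + c + 1 = d → wedgeDet d a b v1 v2 (Function.update v c x) = 0) :
    x ∈ spk v c := by
  have h1 := tri_det hc v1 v2 v hg
  have h2 := hg (d - c) 0 (by omega)
  rw [spk_zero, sup_bot_eq] at h2
  obtain ⟨y, hy, g, hgm, rfl⟩ := Submodule.mem_sup.1 (h2 ▸ Submodule.mem_top : x ∈ _)
  obtain ⟨C, rfl⟩ := spk_exists _ _ _ hy
  rw [← Fin.sum_univ_eq_sum_range (fun l => C l • v1 l)] at *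
  suffices hX : (fun k : Fin (d - c) => C k) = 0 by
    have : ∀ k : Fin (d - c), C k = 0 := fun k => congrFun hX k
    simpa [this] using hgm
  apply Matrix.mulVec_injective_iff_isUnit.2 h1
  rw [Matrix.mulVec_zero]
  ext a
  have ha := a.2
  have hab : (a : ℕ) + (d - c - 1 - a) + c + 1 = d := by omega
  have h3 := hx a (d - c - 1 - a) hab
  obtain ⟨φ, hφ⟩ := wedgeDet_linear hab v1 v2 v
  have h4 : φ g = 0 := by
    have : spk v c ≤ LinearMap.ker φ := spk_le fun m hm => by
      rw [LinearMap.mem_ker, hφ]; exact wedgeDet_update_v3 hab v1 v2 v hm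
    exact this hgm
  rw [← hφ, map_add, h4, add_zero, hφ, tri_sum hab] at h3
  simpa [Matrix.mulVec, dotProduct] using h3

/-- the triple ratio computed from explicit families of vectors -/
def TR (d : ℕ) (j : ℕ × ℕ × ℕ) (v1 v2 v3 : ℕ → Fin d → ℂ) : ℂ :=
  (wedgeDet d (j.1 + 1) j.2.1 v1 v2 v3 * wedgeDet d j.1 (j.2.1 - 1) v1 v2 v3 *
      wedgeDet d (j.1 - 1) (j.2.1 + 1) v1 v2 v3) /
    (wedgeDet d (j.1 - 1) j.2.1 v1 v2 v3 * wedgeDet d j.1 (j.2.1 + 1) v1 v2 v3 *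
      wedgeDet d (j.1 + 1) (j.2.1 - 1) v1 v2 v3)

/-- general position for families of vectors -/
def GPf (d : ℕ) (v1 v2 v3 : ℕ → Fin d → ℂ) : Prop :=
  ∀ a b c, a + b + c = d → wedgeDet d a b v1 v2 v3 ≠ 0

theorem wedgeDet_change' {d c : ℕ} (hc : c ≤ d) {v1 v2 v w : ℕ → Fin d → ℂ}
    (hw : GPf d v1 v2 w) (h : spk w c ≤ spk v c) :
    ∃ κ : ℂ, κ ≠ 0 ∧
      ∀ a b, a + b + c = d → wedgeDet d a b v1 v2 w = κ * wedgeDet d a b v1 v2 v := by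
  obtain ⟨κ, hκ⟩ := wedgeDet_change v1 v2 v w h
  refine ⟨κ, ?_, hκ⟩
  rintro rfl
  have h1 := hκ (d - c) 0 (by omega)
  rw [zero_mul] at h1
  exact hw (d - c) 0 c (by omega) h1

theorem TR_change {d : ℕ} {v1 v2 v w : ℕ → Fin d → ℂ} (hw : GPf d v1 v2 w)
    (h : ∀ c, c ≤ d → spk w c = spk v c) {j : ℕ × ℕ × ℕ} (hj : memB d j) :
    TR d j v1 v2 w = TR d j v1 v2 v := by
  obtain ⟨a, b, c⟩ := j
  obtain ⟨ha, hb, hc, hs⟩ := hj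
  simp only at ha hb hc hs
  obtain ⟨k0, hk0, e0⟩ := wedgeDet_change' (c := c - 1) (by omega) hw (h _ (by omega)).le
  obtain ⟨k1, hk1, e1⟩ := wedgeDet_change' (c := c) (by omega) hw (h _ (by omega)).le
  obtain ⟨k2, hk2, e2⟩ := wedgeDet_change' (c := c + 1) (by omega) hw (h _ (by omega)).le
  simp only [TR]
  rw [e0 (a + 1) b (by omega), e2 a (b - 1) (by omega), e1 (a - 1) (b + 1) (by omega),
    e2 (a - 1) b (by omega), e0 a (b + 1) (by omega), e1 (a + 1) (b - 1) (by omega)]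
  rw [show ∀ X1 X2 X3 : ℂ, k0 * X1 * (k2 * X2) * (k1 * X3) = (k0 * k1 * k2) * (X1 * X2 * X3) from
    fun _ _ _ => by ring, show ∀ X1 X2 X3 : ℂ, k2 * X1 * (k0 * X2) * (k1 * X3) =
    (k0 * k1 * k2) * (X1 * X2 * X3) from fun _ _ _ => by ring]
  exact mul_div_mul_left _ _ (mul_ne_zero (mul_ne_zero hk0 hk1) hk2)

theorem exists_family {d : ℕ} (v1 v2 v0 : ℕ → Fin d → ℂ) (h0 : GPf d v1 v2 v0)
    (t : ℕ × ℕ × ℕ → ℂ) (ht : ∀ j, memB d j → t j ≠ 0) :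
    ∀ c, 1 ≤ c → c ≤ d → ∃ v : ℕ → Fin d → ℂ, v 0 = v0 0 ∧
      (∀ a b c', c' ≤ c → a + b + c' = d → wedgeDet d a b v1 v2 v ≠ 0) ∧
      ∀ j, memB d j → j.2.2 + 1 ≤ c → TR d j v1 v2 v = t j := by
  intro c hc
  induction c, hc using Nat.le_induction with
  | base =>
    intro hd
    refine ⟨v0, rfl, fun a b c' _ h => h0 a b c' h, ?_⟩
    rintro ⟨a, b, c⟩ ⟨_, _, h, _⟩ h'
    simp only at h h'
    omega
  | succ c hc ih =>
    intro hd
    obtain ⟨v, hv0, hvW, hvT⟩ := ih (by omega)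
    let r : ℕ → ℂ := fun a => t (a, d - c - a, c) *
      (wedgeDet d a (d - c - a + 1) v1 v2 v * wedgeDet d (a + 1) (d - c - a - 1) v1 v2 v) /
      (wedgeDet d (a + 1) (d - c - a) v1 v2 v * wedgeDet d (a - 1) (d - c - a + 1) v1 v2 v)
    have hr : ∀ a, 0 < a → a + c < d → r a ≠ 0 := by
      intro a ha hac
      refine div_ne_zero (mul_ne_zero (ht _ ⟨ha, ?_, hc, ?_⟩) (mul_ne_zero ?_ ?_)) (mul_ne_zero ?_ ?_)
      · simp only; omega
      · simp only; omega
      · exact hvW _ _ (c - 1) (by omega) (by omega)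
      · exact hvW _ _ c (by omega) (by omega)
      · exact hvW _ _ (c - 1) (by omega) (by omega)
      · exact hvW _ _ c (by omega) (by omega)
    let y : ℕ → ℂ := fun a => ∏ i ∈ Finset.range a, r (i + 1)
    have hy : ∀ a, a + c < d → y a ≠ 0 := by
      intro a ha
      refine Finset.prod_ne_zero_iff.2 fun i hi => ?_
      have := Finset.mem_range.1 hi
      exact hr _ (by omega) (by omega)
    obtain ⟨x, hx⟩ := tri_surj (c := c) (by omega) v1 v2 v
      (fun a b hab => (wedgeDet_ne_zero_iff hab v1 v2 v).1 (hvW a b c le_rfl hab)) y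
    have hold : ∀ a b, d ≤ a + b + c →
        wedgeDet d a b v1 v2 (Function.update v c x) = wedgeDet d a b v1 v2 v := by
      intro a b hab
      exact wedgeDet_congr _ _ _ _ _ fun m hm => Function.update_of_ne (by omega) _ _
    refine ⟨Function.update v c x, ?_, ?_, ?_⟩
    · rw [Function.update_of_ne (by omega), hv0]
    · intro a b c' hc' hab
      by_cases h : c' ≤ c
      · rw [hold a b (by omega)]
        exact hvW a b c' h hab
      · rw [hx a b (by omega)]
        exact hy a (by omega)
    · rintro ⟨a, b, c'⟩ hj hc'
      have hj' := hj
      obtain ⟨ha, hb, hcp, hs⟩ := hj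
      simp only at ha hb hcp hs hc'
      by_cases h : c' + 1 ≤ c
      · rw [← hvT _ hj' h]
        simp only [TR]
        rw [hold, hold, hold, hold, hold, hold] <;> omega
      · obtain rfl : c' = c := by omega
        obtain rfl : b = d - c' - a := by omega
        obtain ⟨a, rfl⟩ : ∃ a', a = a' + 1 := ⟨a - 1, by omega⟩
        simp only [TR]
        rw [hold (a + 1 + 1) _ (by omega), hold (a + 1 - 1) _ (by omega),
          hold (a + 1) (d - c' - (a + 1) + 1) (by omega), hold (a + 1 + 1) _ (by omega),
          hx (a + 1) _ (by omega), hx (a + 1 - 1) _ (by omega)]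
        have e1 : y (a + 1) = y (a + 1 - 1) * r (a + 1) := by
          simp only [y, Finset.prod_range_succ, Nat.add_sub_cancel]
        have n1 : y (a + 1 - 1) ≠ 0 := hy _ (by omega)
        have n2 : wedgeDet d (a + 1) (d - c' - (a + 1) + 1) v1 v2 v ≠ 0 :=
          hvW _ _ (c' - 1) (by omega) (by omega)
        have n3 : wedgeDet d (a + 1 + 1) (d - c' - (a + 1) - 1) v1 v2 v ≠ 0 :=
          hvW _ _ c' (by omega) (by omega)
        have n4 : wedgeDet d (a + 1 + 1) (d - c' - (a + 1)) v1 v2 v ≠ 0 :=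
          hvW _ _ (c' - 1) (by omega) (by omega)
        have n5 : wedgeDet d (a + 1 - 1) (d - c' - (a + 1) + 1) v1 v2 v ≠ 0 :=
          hvW _ _ c' (by omega) (by omega)
        rw [e1]
        simp only [r]
        generalize wedgeDet d (a + 1) (d - c' - (a + 1) + 1) v1 v2 v = W1 at *
        generalize wedgeDet d (a + 1 + 1) (d - c' - (a + 1) - 1) v1 v2 v = W2 at *
        generalize wedgeDet d (a + 1 + 1) (d - c' - (a + 1)) v1 v2 v = W3 at *
        generalize wedgeDet d (a + 1 - 1) (d - c' - (a + 1) + 1) v1 v2 v = W4 at *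
        generalize y (a + 1 - 1) = Y at *
        field_simp

theorem family_unique {d : ℕ} {v1 v2 v w : ℕ → Fin d → ℂ} (hv : GPf d v1 v2 v)
    (hw : GPf d v1 v2 w) (h1 : spk w 1 = spk v 1)
    (hT : ∀ j, memB d j → TR d j v1 v2 w = TR d j v1 v2 v) :
    ∀ c, c ≤ d → spk w c = spk v c := by
  intro n
  induction n using Nat.strong_induction_on with
  | _ n ih =>
  intro hn
  rcases Nat.lt_or_ge n 2 with h2 | h2
  · obtain rfl | rfl : n = 0 ∨ n = 1 := by omega
    · rw [spk_zero, spk_zero]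
    · exact h1
  obtain ⟨c, rfl⟩ : ∃ c, n = c + 1 := ⟨n - 1, by omega⟩
  have hsc := ih c (by omega) (by omega)
  obtain ⟨k0, hk0, e0⟩ := wedgeDet_change' (c := c - 1) (by omega) hw
    (ih (c - 1) (by omega) (by omega)).le
  obtain ⟨k1, hk1, e1⟩ := wedgeDet_change' (c := c) (by omega) hw hsc.le
  have hs2 : spk w (c + 1) = spk (Function.update v c (w c)) (c + 1) := by
    rw [spk_update_succ, spk_succ, hsc]
  obtain ⟨k2, hk2, e2⟩ := wedgeDet_change' (c := c + 1) (by omega) hw hs2.le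
  let U : ℕ → ℂ := fun a => wedgeDet d a (d - c - 1 - a) v1 v2 v
  let U' : ℕ → ℂ := fun a => wedgeDet d a (d - c - 1 - a) v1 v2 w
  have hU : ∀ a, a < d - c → U a ≠ 0 := fun a ha => hv _ _ (c + 1) (by omega)
  have hU' : ∀ a, a < d - c → U' a ≠ 0 := fun a ha => hw _ _ (c + 1) (by omega)
  have hstep : ∀ a, a + 1 < d - c → U' (a + 1) * U a = U (a + 1) * U' a := by
    intro a ha
    have h3 := hT (a + 1, d - c - 1 - a, c) ⟨by simp, by simp only; omega, by simp only; omega,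
      by simp only; omega⟩
    simp only [TR, Nat.add_sub_cancel] at h3
    rw [e0 (a + 1 + 1) (d - c - 1 - a) (by omega), e1 a (d - c - 1 - a + 1) (by omega),
      e0 (a + 1) (d - c - 1 - a + 1) (by omega),
      e1 (a + 1 + 1) (d - c - 1 - a - 1) (by omega)] at h3
    have i1 : wedgeDet d (a + 1) (d - c - 1 - a - 1) v1 v2 w = U' (a + 1) := rfl
    have i2 : wedgeDet d (a + 1) (d - c - 1 - a - 1) v1 v2 v = U (a + 1) := rfl
    have i3 : wedgeDet d a (d - c - 1 - a) v1 v2 w = U' a := rfl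
    have i4 : wedgeDet d a (d - c - 1 - a) v1 v2 v = U a := rfl
    rw [i1, i2, i3, i4] at h3
    have n1 := hv (a + 1 + 1) (d - c - 1 - a) (c - 1) (by omega)
    have n2 := hv a (d - c - 1 - a + 1) c (by omega)
    have n3 := hv (a + 1) (d - c - 1 - a + 1) (c - 1) (by omega)
    have n4 := hv (a + 1 + 1) (d - c - 1 - a - 1) c (by omega)
    have n5 := hU a (by omega)
    have n6 := hU' a (by omega)
    generalize wedgeDet d (a + 1 + 1) (d - c - 1 - a) v1 v2 v = W1 at *
    generalize wedgeDet d a (d - c - 1 - a + 1) v1 v2 v = W2 at *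
    generalize wedgeDet d (a + 1) (d - c - 1 - a + 1) v1 v2 v = W3 at *
    generalize wedgeDet d (a + 1 + 1) (d - c - 1 - a - 1) v1 v2 v = W4 at *
    generalize U a = Ua at *
    generalize U' a = Ua' at *
    generalize U (a + 1) = Ub at *
    generalize U' (a + 1) = Ub' at *
    field_simp at h3
    linear_combination h3
  have hprop : ∀ a, a < d - c → U' a * U 0 = U' 0 * U a := by
    intro a
    induction a with
    | zero => intro _; rfl
    | succ a iha =>
      intro ha
      apply mul_right_cancel₀ (hU a (by omega))
      linear_combination U 0 * hstep a ha + U (a + 1) * iha (by omega)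
  have hU0 := hU 0 (by omega)
  have hU0' := hU' 0 (by omega)
  set μ : ℂ := U' 0 / (k2 * U 0) with hμ
  have hμ0 : μ ≠ 0 := div_ne_zero hU0' (mul_ne_zero hk2 hU0)
  have hx : w c - μ • v c ∈ spk v c := by
    apply tri_inj (by omega) v1 v2 v
      (fun a b hab => (wedgeDet_ne_zero_iff hab v1 v2 v).1 (hv a b c hab))
    intro a b hab
    obtain ⟨φ, hφ⟩ := wedgeDet_linear hab v1 v2 v
    obtain rfl : b = d - c - 1 - a := by omega
    have h4 : U' a = k2 * φ (w c) := by
      rw [hφ]; exact e2 a _ (by omega)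
    have h5 : φ (v c) = U a := by
      rw [hφ, Function.update_eq_self]
    rw [← hφ, map_sub, map_smul, h5, smul_eq_mul, hμ]
    have h6 := hprop a (by omega)
    rw [h4] at h6
    field_simp
    linear_combination h6
  apply le_antisymm
  · rw [spk_succ, hsc]
    refine sup_le (spk_mono v (by omega)) ?_
    rw [Submodule.span_singleton_le_iff_mem]
    have : w c = (w c - μ • v c) + μ • v c := by abel
    rw [this]
    exact add_mem (spk_mono v (by omega) hx) (Submodule.smul_mem _ _ (spk_mem v (by omega)))
  · rw [spk_succ, ← hsc]
    refine sup_le (spk_mono w (by omega)) ?_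
    rw [Submodule.span_singleton_le_iff_mem]
    have : v c = μ⁻¹ • w c - μ⁻¹ • (w c - μ • v c) := by
      rw [smul_sub, smul_smul, inv_mul_cancel₀ hμ0, one_smul]; abel
    rw [this]
    rw [← hsc] at hx
    exact sub_mem (Submodule.smul_mem _ _ (spk_mem w (by omega)))
      (Submodule.smul_mem _ _ (spk_mono w (by omega) hx))

theorem flag_zero {d : ℕ} {F : ℕ → Submodule ℂ (Fin d → ℂ)} (hF : IsCompleteFlag d F) :
    F 0 = ⊥ :=
  Submodule.finrank_eq_zero.1 (hF.2 0 (Nat.zero_le d))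

theorem flag_top {d : ℕ} {F : ℕ → Submodule ℂ (Fin d → ℂ)} (hF : IsCompleteFlag d F)
    {k : ℕ} (hk : d ≤ k) : F k = ⊤ := by
  have h : F d = ⊤ := Submodule.eq_top_of_finrank_eq (by rw [hF.2 d le_rfl]; simp)
  exact top_le_iff.1 (h ▸ hF.1 hk)

theorem adapted_of {d : ℕ} {F : ℕ → Submodule ℂ (Fin d → ℂ)} (hF : IsCompleteFlag d F)
    {p : ℕ → Fin d → ℂ} (hp : ∀ k, k < d → p k ∈ F (k + 1) ∧ p k ∉ F k) :
    ∀ k, k ≤ d → F k = spk p k := by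
  intro k
  induction k with
  | zero => intro _; rw [flag_zero hF, spk_zero]
  | succ k ih =>
    intro hk
    have h1 := ih (by omega)
    symm
    apply Submodule.eq_of_le_of_finrank_le
    · exact spk_le fun m hm => hF.1 (by omega) (hp m (by omega)).1
    · have h2 : F k < spk p (k + 1) := by
        refine lt_of_le_of_ne ?_ ?_
        · rw [h1]; exact spk_mono p (by omega)
        · intro h
          apply (hp k (by omega)).2
          rw [h]
          exact spk_mem p (by omega)
      have h3 := Submodule.finrank_lt_finrank_of_lt h2
      rw [hF.2 k (by omega)] at h3
      rw [hF.2 (k + 1) hk]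
      exact h3

theorem exists_adapted {d : ℕ} {F : ℕ → Submodule ℂ (Fin d → ℂ)} (hF : IsCompleteFlag d F) :
    ∃ v, IsAdaptedBasis d F v := by
  have h : ∀ k, ∃ x, k < d → x ∈ F (k + 1) ∧ x ∉ F k := by
    intro k
    by_cases hk : k < d
    · have h2 : F k < F (k + 1) := by
        refine lt_of_le_of_ne (hF.1 (by omega)) fun h => ?_
        have e1 := hF.2 k (by omega)
        have e2 := hF.2 (k + 1) (by omega)
        rw [h] at e1
        omega
      obtain ⟨x, hx⟩ := SetLike.exists_of_lt h2
      exact ⟨x, fun _ => hx⟩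
    · exact ⟨0, fun h => absurd h hk⟩
  choose p hp using h
  exact ⟨p, adapted_of hF hp⟩

theorem flagBasis_spec {d : ℕ} {F : ℕ → Submodule ℂ (Fin d → ℂ)}
    (h : ∃ v, IsAdaptedBasis d F v) : ∀ k, k ≤ d → F k = spk (flagBasis d F) k :=
  Classical.epsilon_spec h

theorem finrank_spk_le {d : ℕ} (v : ℕ → Fin d → ℂ) (k : ℕ) :
    Module.finrank ℂ (spk v k) ≤ k := by
  induction k with
  | zero => rw [spk_zero]; simp
  | succ k ih =>
    rw [spk_succ]
    have h1 := Submodule.finrank_add_le_finrank_add_finrank (spk v k) (Submodule.span ℂ {v k})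
    have h2 : Module.finrank ℂ (Submodule.span ℂ {v k}) ≤ 1 := by
      simpa using finrank_span_le_card (R := ℂ) ({v k} : Set (Fin d → ℂ))
    omega

theorem inf_bot_of {d : ℕ} {S T : Submodule ℂ (Fin d → ℂ)} (h : S ⊔ T = ⊤)
    (hr : Module.finrank ℂ S + Module.finrank ℂ T ≤ d) : S ⊓ T = ⊥ := by
  have h1 := Submodule.finrank_sup_add_finrank_inf_eq S T
  rw [h] at h1
  simp only [finrank_top, Module.finrank_fin_fun] at h1
  exact Submodule.finrank_eq_zero.1 (by omega)

theorem not_mem_of {d : ℕ} {u : Fin d → ℂ} {S T : Submodule ℂ (Fin d → ℂ)}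
    (h : Submodule.span ℂ {u} ⊔ S ⊔ T = ⊤)
    (hr : Module.finrank ℂ S + Module.finrank ℂ T < d) : u ∉ S ⊔ T := by
  intro hu
  rw [sup_assoc, sup_eq_right.2 ((Submodule.span_singleton_le_iff_mem _ _).2 hu)] at h
  have h1 := Submodule.finrank_add_le_finrank_add_finrank S T
  rw [h] at h1
  simp only [finrank_top, Module.finrank_fin_fun] at h1
  omega

theorem frame {d : ℕ} {A B : ℕ → Submodule ℂ (Fin d → ℂ)} (hA : IsCompleteFlag d A)
    (hB : IsCompleteFlag d B) (u : Fin d → ℂ) (hAB : ∀ k, k ≤ d → A k ⊔ B (d - k) = ⊤)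
    (hu : ∀ k, k < d → u ∉ A k ⊔ B (d - 1 - k)) :
    ∃ p : ℕ → Fin d → ℂ, (∑ i ∈ Finset.range d, p i = u) ∧ (∀ k, k ≤ d → A k = spk p k) ∧
      (∀ k, k ≤ d → B k = spk (fun m => p (d - 1 - m)) k) ∧
      ∀ k, k ≤ d → u - ∑ i ∈ Finset.range k, p i ∈ B (d - k) := by
  have h : ∀ k, ∃ x, k ≤ d → x ∈ A k ∧ u - x ∈ B (d - k) := by
    intro k
    by_cases hk : k ≤ d
    · obtain ⟨x, hx, y, hy, hxy⟩ := Submodule.mem_sup.1 (hAB k hk ▸ Submodule.mem_top : u ∈ _)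
      refine ⟨x, fun _ => ⟨hx, ?_⟩⟩
      rw [← hxy]
      simpa using hy
    · exact ⟨0, fun h => absurd h hk⟩
  choose α hα using h
  have h0 : α 0 = 0 := by
    have := (hα 0 (by omega)).1
    rw [flag_zero hA] at this
    simpa using this
  have hd : α d = u := by
    have := (hα d le_rfl).2
    rw [Nat.sub_self, flag_zero hB, Submodule.mem_bot, sub_eq_zero] at this
    exact this.symm
  have hsum : ∀ k, ∑ i ∈ Finset.range k, (α (i + 1) - α i) = α k := by
    intro k
    rw [Finset.sum_range_sub, h0, sub_zero]
  refine ⟨fun k => α (k + 1) - α k, by rw [hsum, hd], ?_, ?_, ?_⟩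
  · refine adapted_of hA fun k hk => ⟨?_, fun hh => ?_⟩
    · exact sub_mem (hα (k + 1) (by omega)).1 (hA.1 (by omega) (hα k (by omega)).1)
    · apply hu k hk
      have h1 : α (k + 1) ∈ A k := by
        have := add_mem hh (hα k (by omega)).1
        simpa using this
      have h2 := (hα (k + 1) (by omega)).2
      rw [show d - (k + 1) = d - 1 - k by omega] at h2
      exact Submodule.mem_sup.2 ⟨_, h1, _, h2, by abel⟩
  · refine adapted_of hB fun m hm => ?_
    obtain ⟨k, hk, rfl⟩ : ∃ k, k < d ∧ m = d - 1 - k := ⟨d - 1 - m, by omega, by omega⟩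
    have e1 : d - 1 - (d - 1 - k) = k := by omega
    have e2 : d - 1 - k + 1 = d - k := by omega
    have e3 : d - (k + 1) = d - 1 - k := by omega
    have b1 := (hα (k + 1) (by omega)).2
    have b0 := (hα k (by omega)).2
    rw [e3] at b1
    simp only [e1, e2]
    refine ⟨?_, fun hh => ?_⟩
    · have := sub_mem b0 (hB.1 (show d - 1 - k ≤ d - k by omega) b1)
      simpa using this
    · apply hu k hk
      have h1 := add_mem hh b1
      exact Submodule.mem_sup.2 ⟨_, (hα k (by omega)).1, _, h1, by abel⟩
  · intro k hk
    rw [hsum]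
    exact (hα k hk).2

theorem map_spk {d : ℕ} {p q : ℕ → Fin d → ℂ} {k : ℕ} {f : (Fin d → ℂ) →ₗ[ℂ] (Fin d → ℂ)}
    (h : ∀ m, m < k → f (p m) = q m) : Submodule.map f (spk p k) = spk q k := by
  rw [spk, Submodule.map_span, Set.image_image]
  exact spk_congr (v := fun m => f (p m)) h

theorem span_range_spk {d : ℕ} (p : ℕ → Fin d → ℂ) :
    Submodule.span ℂ (Set.range fun i : Fin d => p i) = spk p d := by
  unfold spk
  congr 1
  ext x
  constructor
  · rintro ⟨i, rfl⟩; exact ⟨i, i.2, rfl⟩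
  · rintro ⟨i, hi, rfl⟩; exact ⟨⟨i, hi⟩, rfl⟩

theorem exists_map {d : ℕ} {p q : ℕ → Fin d → ℂ} (hp : spk p d = ⊤) (hq : spk q d = ⊤) :
    ∃ a : Matrix (Fin d) (Fin d) ℂ, IsUnit a ∧ ∀ k, k < d → a.mulVecLin (p k) = q k := by
  let bp := basisOfTopLeSpanOfCardEqFinrank (R := ℂ) (fun i : Fin d => p i)
    (by rw [span_range_spk, hp]) (by simp)
  let bq := basisOfTopLeSpanOfCardEqFinrank (R := ℂ) (fun i : Fin d => q i)
    (by rw [span_range_spk, hq]) (by simp)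
  let E := bp.equiv bq (Equiv.refl _)
  have hE : (LinearMap.toMatrix' (E : (Fin d → ℂ) →ₗ[ℂ] (Fin d → ℂ))).mulVecLin
      = (E : (Fin d → ℂ) →ₗ[ℂ] (Fin d → ℂ)) := by
    rw [← Matrix.toLin'_apply', Matrix.toLin'_toMatrix']
  refine ⟨LinearMap.toMatrix' (E : (Fin d → ℂ) →ₗ[ℂ] (Fin d → ℂ)), ?_, ?_⟩
  · rw [← Matrix.mulVec_injective_iff_isUnit, ← Matrix.coe_mulVecLin, hE]
    exact E.injective
  · intro k hk
    rw [hE]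
    have h1 : bp ⟨k, hk⟩ = p k := by
      simp [bp, coe_basisOfTopLeSpanOfCardEqFinrank]
    have h2 : bq ⟨k, hk⟩ = q k := by
      simp [bq, coe_basisOfTopLeSpanOfCardEqFinrank]
    rw [← h1, ← h2]
    simp [E]

theorem GPf_of {d : ℕ} {F1 F2 F3 : ℕ → Submodule ℂ (Fin d → ℂ)} {v1 v2 v3 : ℕ → Fin d → ℂ}
    (hg : GenPos3 d F1 F2 F3) (e1 : ∀ k, k ≤ d → F1 k = spk v1 k)
    (e2 : ∀ k, k ≤ d → F2 k = spk v2 k) (e3 : ∀ k, k ≤ d → F3 k = spk v3 k) :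
    GPf d v1 v2 v3 := by
  intro a b c h
  rw [wedgeDet_ne_zero_iff h, ← e1 a (by omega), ← e2 b (by omega), ← e3 c (by omega)]
  exact hg a b c h

theorem flag_of_GPf {d : ℕ} {v1 v2 v : ℕ → Fin d → ℂ} (h : GPf d v1 v2 v) :
    IsCompleteFlag d (spk v) := by
  refine ⟨spk_mono v, fun k hk => le_antisymm (finrank_spk_le v k) ?_⟩
  have h1 := (wedgeDet_ne_zero_iff (c := k) (by omega) v1 v2 v).1 (h (d - k) 0 k (by omega))
  rw [spk_zero, sup_bot_eq] at h1
  have h2 := Submodule.finrank_add_le_finrank_add_finrank (spk v1 (d - k)) (spk v k)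
  rw [h1] at h2
  simp only [finrank_top, Module.finrank_fin_fun] at h2
  have h3 := finrank_spk_le v1 (d - k)
  omega

theorem flagMap_adapted {d : ℕ} {F : ℕ → Submodule ℂ (Fin d → ℂ)} {v : ℕ → Fin d → ℂ}
    (a : Matrix (Fin d) (Fin d) ℂ) (e : ∀ k, k ≤ d → F k = spk v k) :
    ∃ w, IsAdaptedBasis d (flagMap d a F) w := by
  refine ⟨fun m => a.mulVecLin (v m), fun k hk => ?_⟩
  unfold flagMap
  rw [e k hk]
  exact map_spk fun m _ => rfl

theorem frame_of_gen {d : ℕ} (hd : 2 ≤ d) {F1 A B : ℕ → Submodule ℂ (Fin d → ℂ)}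
    (h1 : IsCompleteFlag d F1) (hA : IsCompleteFlag d A) (hB : IsCompleteFlag d B)
    (hg : GenPos3 d F1 A B) {u : Fin d → ℂ} (hu : F1 1 = Submodule.span ℂ {u}) :
    ∃ p : ℕ → Fin d → ℂ, (∑ i ∈ Finset.range d, p i = u) ∧ (∀ k, k ≤ d → A k = spk p k) ∧
      (∀ k, k ≤ d → B k = spk (fun m => p (d - 1 - m)) k) ∧
      ∀ k, k ≤ d → u - ∑ i ∈ Finset.range k, p i ∈ B (d - k) := by
  apply frame hA hB
  · intro k hk
    have := hg 0 k (d - k) (by omega)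
    rwa [flag_zero h1, bot_sup_eq] at this
  · intro k hk
    apply not_mem_of
    · rw [← hu]
      exact hg 1 k (d - 1 - k) (by omega)
    · rw [hA.2 k (by omega), hB.2 _ (by omega)]
      omega

theorem map_top_of_unit {d : ℕ} {a : Matrix (Fin d) (Fin d) ℂ} (ha : IsUnit a) :
    Submodule.map a.mulVecLin ⊤ = ⊤ := by
  rw [Submodule.map_top, LinearMap.range_eq_top, Matrix.coe_mulVecLin]
  exact Matrix.mulVec_surjective_iff_isUnit.2 ha

theorem part_exists (d : ℕ) (hd : 2 ≤ d) (F1 F2 F3 : ℕ → Submodule ℂ (Fin d → ℂ))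
    (h1 : IsCompleteFlag d F1) (h2 : IsCompleteFlag d F2) (h3 : IsCompleteFlag d F3)
    (hgen : GenPos3 d F1 F2 F3)
    (z : ℕ × ℕ × ℕ → ℂ) (hz : ∀ j, memB d j → z j ≠ 0) :
    ∃ a : Matrix (Fin d) (Fin d) ℂ, IsUnit a ∧
        flagMap d a F2 = F2 ∧
        Submodule.map a.mulVecLin (F1 1) = F1 1 ∧
        Submodule.map a.mulVecLin (F3 1) = F3 1 ∧
        GenPos3 d F1 F2 (flagMap d a F3) ∧
        ∀ j : ℕ × ℕ × ℕ, memB d j →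
          tripleRatio d j F1 F2 (flagMap d a F3) = z j * tripleRatio d j F1 F2 F3 := by
  have e1 := flagBasis_spec (exists_adapted h1)
  have e2 := flagBasis_spec (exists_adapted h2)
  have e3 := flagBasis_spec (exists_adapted h3)
  have hT : ∀ G j, tripleRatio d j F1 F2 G =
    TR d j (flagBasis d F1) (flagBasis d F2) (flagBasis d G) := fun _ _ => rfl
  simp only [hT]
  set v1 := flagBasis d F1 with hv1
  set v2 := flagBasis d F2 with hv2
  set v3 := flagBasis d F3 with hv3
  have g3 : GPf d v1 v2 v3 := GPf_of hgen e1 e2 e3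
  obtain ⟨v, hv0, hvW, hvT⟩ := exists_family v1 v2 v3 g3 (fun j => z j * TR d j v1 v2 v3)
    (by
      rintro ⟨a, b, c⟩ hj
      refine mul_ne_zero (hz _ hj) ?_
      obtain ⟨ha, hb, hc, hs⟩ := hj
      simp only at ha hb hc hs
      exact div_ne_zero
        (mul_ne_zero (mul_ne_zero (g3 _ _ (c - 1) (by simp only; omega))
          (g3 _ _ (c + 1) (by simp only; omega))) (g3 _ _ c (by simp only; omega)))
        (mul_ne_zero (mul_ne_zero (g3 _ _ (c + 1) (by simp only; omega))
          (g3 _ _ (c - 1) (by simp only; omega))) (g3 _ _ c (by simp only; omega))))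
    d (by omega) le_rfl
  have gv : GPf d v1 v2 v := fun a b c h => hvW a b c (by omega) h
  have hG := flag_of_GPf gv
  have hgenG : GenPos3 d F1 F2 (spk v) := by
    intro a b c h
    rw [e1 a (by omega), e2 b (by omega)]
    exact (wedgeDet_ne_zero_iff h v1 v2 v).1 (gv a b c h)
  have hu : F1 1 = Submodule.span ℂ {v1 0} := by
    rw [e1 1 (by omega), spk_succ, spk_zero, bot_sup_eq]
  obtain ⟨p, psum, pA, pB, -⟩ := frame_of_gen hd h1 h2 h3 hgen hu
  obtain ⟨q, qsum, qA, qB, -⟩ := frame_of_gen hd h1 h2 hG hgenG hu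
  obtain ⟨a, ha, hpq⟩ := exists_map (p := p) (q := q)
    (by rw [← pA d le_rfl, flag_top h2 le_rfl]) (by rw [← qA d le_rfl, flag_top h2 le_rfl])
  have mapG : ∀ k, k ≤ d → flagMap d a F3 k = spk v k := by
    intro k hk
    unfold flagMap
    rw [pB k hk, qB k hk]
    exact map_spk fun m hm => hpq _ (by omega)
  refine ⟨a, ha, ?_, ?_, ?_, ?_, ?_⟩
  · funext k
    by_cases hk : k ≤ d
    · unfold flagMap
      conv_rhs => rw [qA k hk]
      rw [pA k hk]
      exact map_spk fun m hm => hpq _ (by omega)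
    · unfold flagMap
      rw [flag_top h2 (by omega), map_top_of_unit ha]
  · rw [hu, Submodule.map_span, Set.image_singleton]
    have : a.mulVecLin (v1 0) = v1 0 := by
      conv_lhs => rw [← psum]
      rw [← qsum, map_sum]
      exact Finset.sum_congr rfl fun i hi => hpq i (Finset.mem_range.1 hi)
    rw [this]
  · have := mapG 1 (by omega)
    unfold flagMap at this
    rw [this, e3 1 (by omega)]
    apply spk_congr
    intro m hm
    obtain rfl : m = 0 := by omega
    exact hv0
  · intro k1 k2 k3 h
    rw [mapG k3 (by omega)]
    exact hgenG k1 k2 k3 h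
  · intro j hj
    have ew := flagBasis_spec (flagMap_adapted a e3)
    rw [← hvT j hj (by obtain ⟨x, y, z, w⟩ := hj; omega)]
    symm
    exact TR_change gv (fun c hc => by rw [← ew c hc, mapG c hc]) hj

theorem eig_of {d : ℕ} {a : Matrix (Fin d) (Fin d) ℂ} (ha : IsUnit a) {u : Fin d → ℂ} (hu0 : u ≠ 0)
    {L : Submodule ℂ (Fin d → ℂ)} (hL : L = Submodule.span ℂ {u})
    (h : Submodule.map a.mulVecLin L = L) : ∃ μ : ℂ, μ ≠ 0 ∧ a.mulVecLin u = μ • u := by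
  have h1 : a.mulVecLin u ∈ Submodule.span ℂ {u} := by
    rw [← hL, ← h]
    exact Submodule.mem_map_of_mem (hL ▸ Submodule.mem_span_singleton_self u)
  obtain ⟨μ, hμ⟩ := Submodule.mem_span_singleton.1 h1
  refine ⟨μ, ?_, hμ.symm⟩
  rintro rfl
  rw [zero_smul] at hμ
  apply hu0
  apply Matrix.mulVec_injective_iff_isUnit.2 ha
  rw [← Matrix.mulVecLin_apply, ← hμ, Matrix.mulVec_zero]

theorem part_unique (d : ℕ) (hd : 2 ≤ d) (F1 F2 F3 : ℕ → Submodule ℂ (Fin d → ℂ))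
    (h1 : IsCompleteFlag d F1) (h2 : IsCompleteFlag d F2) (h3 : IsCompleteFlag d F3)
    (hgen : GenPos3 d F1 F2 F3) (a a' : Matrix (Fin d) (Fin d) ℂ)
    (ha : IsUnit a) (haF2 : flagMap d a F2 = F2)
    (haF1 : Submodule.map a.mulVecLin (F1 1) = F1 1)
    (haF3 : Submodule.map a.mulVecLin (F3 1) = F3 1)
    (hag : GenPos3 d F1 F2 (flagMap d a F3))
    (ha' : IsUnit a') (haF2' : flagMap d a' F2 = F2)
    (haF1' : Submodule.map a'.mulVecLin (F1 1) = F1 1)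
    (haF3' : Submodule.map a'.mulVecLin (F3 1) = F3 1)
    (hag' : GenPos3 d F1 F2 (flagMap d a' F3))
    (hTT : ∀ j : ℕ × ℕ × ℕ, memB d j →
          tripleRatio d j F1 F2 (flagMap d a' F3) = tripleRatio d j F1 F2 (flagMap d a F3)) :
    ∃ c : ℂ, c ≠ 0 ∧ a' = c • a := by
  have e1 := flagBasis_spec (exists_adapted h1)
  have e2 := flagBasis_spec (exists_adapted h2)
  have e3 := flagBasis_spec (exists_adapted h3)
  have ew := flagBasis_spec (flagMap_adapted a e3)
  have ew' := flagBasis_spec (flagMap_adapted a' e3)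
  have gw := GPf_of hag e1 e2 ew
  have gw' := GPf_of hag' e1 e2 ew'
  have hsame := family_unique gw gw'
    (by rw [← ew 1 (by omega), ← ew' 1 (by omega)]
        unfold flagMap
        rw [haF3, haF3']) hTT
  have hG : ∀ k, k ≤ d → flagMap d a' F3 k = flagMap d a F3 k := fun k hk => by
    rw [ew k hk, ew' k hk, hsame k hk]
  have hu : F1 1 = Submodule.span ℂ {flagBasis d F1 0} := by
    rw [e1 1 (by omega), spk_succ, spk_zero, bot_sup_eq]
  have hu0 : flagBasis d F1 0 ≠ 0 := by
    intro h
    have h5 := h1.2 1 (by omega)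
    rw [hu, h, Submodule.span_zero_singleton, finrank_bot] at h5
    omega
  set u := flagBasis d F1 0 with hudef
  obtain ⟨μ, hμ, hau⟩ := eig_of ha hu0 hu haF1
  obtain ⟨μ', hμ', hau'⟩ := eig_of ha' hu0 hu haF1'
  obtain ⟨p, psum, pA, pB, pR⟩ := frame_of_gen hd h1 h2 h3 hgen hu
  refine ⟨μ' / μ, div_ne_zero hμ' hμ, ?_⟩
  set D : (Fin d → ℂ) →ₗ[ℂ] (Fin d → ℂ) := a'.mulVecLin - (μ' / μ) • a.mulVecLin with hD
  have hDu : D u = 0 := by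
    simp only [hD, LinearMap.sub_apply, LinearMap.smul_apply, hau, hau', smul_smul]
    rw [div_mul_cancel₀ _ hμ, sub_self]
  have hDA : ∀ k x, x ∈ F2 k → D x ∈ F2 k := by
    intro k x hx
    simp only [hD, LinearMap.sub_apply, LinearMap.smul_apply]
    refine sub_mem ?_ (Submodule.smul_mem _ _ ?_)
    · have : a'.mulVecLin x ∈ flagMap d a' F2 k := Submodule.mem_map_of_mem hx
      rwa [haF2'] at this
    · have : a.mulVecLin x ∈ flagMap d a F2 k := Submodule.mem_map_of_mem hx
      rwa [haF2] at this
  have hDB : ∀ k, k ≤ d → ∀ x, x ∈ F3 k → D x ∈ flagMap d a F3 k := by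
    intro k hk x hx
    simp only [hD, LinearMap.sub_apply, LinearMap.smul_apply]
    refine sub_mem ?_ (Submodule.smul_mem _ _ ?_)
    · rw [← hG k hk]
      exact Submodule.mem_map_of_mem hx
    · exact Submodule.mem_map_of_mem hx
  have hDs : ∀ k, k ≤ d → D (∑ i ∈ Finset.range k, p i) = 0 := by
    intro k hk
    have hin : F2 k ⊓ flagMap d a F3 (d - k) = ⊥ := by
      apply inf_bot_of
      · have := hag 0 k (d - k) (by omega)
        rwa [flag_zero h1, bot_sup_eq] at this
      · have h5 := h2.2 k hk
        have h6 := finrank_spk_le (flagBasis d (flagMap d a F3)) (d - k)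
        rw [← ew (d - k) (by omega)] at h6
        omega
    have m1 : D (∑ i ∈ Finset.range k, p i) ∈ F2 k := by
      apply hDA
      rw [pA k hk]
      exact sum_mem fun i hi => spk_mem p (Finset.mem_range.1 hi)
    have m2 : D (∑ i ∈ Finset.range k, p i) ∈ flagMap d a F3 (d - k) := by
      have := hDB (d - k) (by omega) _ (pR k hk)
      rw [map_sub, hDu, zero_sub] at this
      exact (Submodule.neg_mem_iff _).1 this
    have : D (∑ i ∈ Finset.range k, p i) ∈ F2 k ⊓ flagMap d a F3 (d - k) := ⟨m1, m2⟩
    rw [hin] at this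
    simpa using this
  have hDp : spk p d ≤ LinearMap.ker D := by
    refine spk_le fun k hk => ?_
    have q1 := hDs (k + 1) hk
    rw [Finset.sum_range_succ, map_add, hDs k (by omega), zero_add] at q1
    exact q1
  rw [← pA d le_rfl, flag_top h2 le_rfl, top_le_iff, LinearMap.ker_eq_top, hD, sub_eq_zero] at hDp
  apply Matrix.toLin'.injective
  rw [map_smul, Matrix.toLin'_apply', Matrix.toLin'_apply']
  exact hDp


theorem statement_9 (d : ℕ) (hd : 2 ≤ d) (F1 F2 F3 : ℕ → Submodule ℂ (Fin d → ℂ))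
    (h1 : IsCompleteFlag d F1) (h2 : IsCompleteFlag d F2) (h3 : IsCompleteFlag d F3)
    (hgen : GenPos3 d F1 F2 F3)
    (z : ℕ × ℕ × ℕ → ℂ) (hz : ∀ j, memB d j → z j ≠ 0) :
    (∃ a : Matrix (Fin d) (Fin d) ℂ, IsUnit a ∧
        flagMap d a F2 = F2 ∧
        Submodule.map a.mulVecLin (F1 1) = F1 1 ∧
        Submodule.map a.mulVecLin (F3 1) = F3 1 ∧
        GenPos3 d F1 F2 (flagMap d a F3) ∧
        ∀ j : ℕ × ℕ × ℕ, memB d j →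
          tripleRatio d j F1 F2 (flagMap d a F3) = z j * tripleRatio d j F1 F2 F3) ∧
    -- any two such elements differ by multiplication by a nonzero scalar
    ∀ a a' : Matrix (Fin d) (Fin d) ℂ,
      (IsUnit a ∧ flagMap d a F2 = F2 ∧
        Submodule.map a.mulVecLin (F1 1) = F1 1 ∧
        Submodule.map a.mulVecLin (F3 1) = F3 1 ∧
        GenPos3 d F1 F2 (flagMap d a F3) ∧
        ∀ j : ℕ × ℕ × ℕ, memB d j →
          tripleRatio d j F1 F2 (flagMap d a F3) = z j * tripleRatio d j F1 F2 F3) →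
      (IsUnit a' ∧ flagMap d a' F2 = F2 ∧
        Submodule.map a'.mulVecLin (F1 1) = F1 1 ∧
        Submodule.map a'.mulVecLin (F3 1) = F3 1 ∧
        GenPos3 d F1 F2 (flagMap d a' F3) ∧
        ∀ j : ℕ × ℕ × ℕ, memB d j →
          tripleRatio d j F1 F2 (flagMap d a' F3) = z j * tripleRatio d j F1 F2 F3) →
      ∃ c : ℂ, c ≠ 0 ∧ a' = c • a := by
  refine ⟨part_exists d hd F1 F2 F3 h1 h2 h3 hgen z hz, ?_⟩
  rintro a a' ⟨ha, b1, b2, b3, b4, b5⟩ ⟨ha', c1, c2, c3, c4, c5⟩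
  exact part_unique d hd F1 F2 F3 h1 h2 h3 hgen a a' ha b1 b2 b3 b4 ha' c1 c2 c3 c4
    fun j hj => (c5 j hj).trans (b5 j hj).symm
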